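/- Let Λ be the Bedford–McMullen carpet with a_1 = 3, a_2 = 2 and digit set D = {(0,0),(1,1),(2,0)}, and define φ : Σ → ℝ by φ(ω) = 1 if ω_1 = (2,0) and φ(ω) = 0 otherwise. Then for α ∈ [0,1]: dim_P Π(E_φ(α)) = (−α log α − (1−α) log(1−α) − α log 2)/log 3 + 1 when α ≤ 1/2, and dim_P Π(E_φ(α)) = (−α log α − (1−α) log(1−α))/log 2 + (1−α)·(log 2/log 3) when α > 1/2 (with the convention 0·log 0 = 0). Consequently the packing spectrum α ↦ dim_P Π(E_φ(α)) is not real analytic on (0,1) (its second derivative jumps at α = 1/2), and it attains the full packing dimension dim_P Λ at α = 1/3. -/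

import Mathlib

open MeasureTheory Filter Topology Metric Set
open scoped ENNReal NNReal

noncomputable section

/-- Shannon entropy of the partition of `X` induced by a map into a finite type. -/
def entPart {X : Type*} [MeasurableSpace X] (μ : Measure X) {ι : Type*} [Fintype ι]
    (p : X → ι) : ℝ :=
  ∑ i, Real.negMulLog ((μ (p ⁻¹' {i})).toReal)

/-- Kolmogorov–Sinai (measure-theoretic) entropy of `T` with respect to `μ`:
the supremum over finite measurable partitions (coded by measurable maps into `Fin m`)
of the limit (= infimum, by subadditivity) of the averaged entropies of the dynamical
refinements of the partition. -/
def ksEntropy {X : Type*} [MeasurableSpace X] (T : X → X) (μ : Measure X) : ℝ :=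
  ⨆ m : ℕ, ⨆ p : {p : X → Fin m // Measurable p},
    ⨅ n : ℕ, ((n : ℝ) + 1)⁻¹ *
      entPart μ (fun x => fun k : Fin (n + 1) => p.1 (T^[(k : ℕ)] x))

/-- Minimal number of balls of radius `r` needed to cover `s`. -/
def coverN {X : Type*} [PseudoMetricSpace X] (s : Set X) (r : ℝ) : ℕ :=
  sInf {n : ℕ | ∃ t : Finset X, t.card = n ∧ s ⊆ ⋃ x ∈ t, Metric.ball x r}

/-- Upper box (Minkowski) dimension. -/
def upperBoxDim {X : Type*} [PseudoMetricSpace X] (s : Set X) : ℝ :=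
  Filter.limsup (fun r : ℝ => Real.log (coverN s r) / Real.log r⁻¹) (nhdsWithin 0 (Set.Ioi 0))

/-- Packing dimension, via countable covers and upper box dimension. -/
def packingDim {X : Type*} [PseudoMetricSpace X] (s : Set X) : ℝ :=
  ⨅ C : {C : ℕ → Set X // s ⊆ ⋃ n, C n}, ⨆ n, upperBoxDim (C.1 n)

/-- The `n`-th empirical (Birkhoff average) measure `A_{n+1}(δ_x)` of the orbit of `x`. -/
def empirical {X : Type*} [MeasurableSpace X] (T : X → X) (x : X) (n : ℕ) : Measure X :=
  (((n : ℝ≥0∞) + 1))⁻¹ • ∑ l ∈ Finset.range (n + 1), Measure.dirac (T^[l] x)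

instance empirical_prob {X : Type*} [MeasurableSpace X] (T : X → X) (x : X) (n : ℕ) :
    IsProbabilityMeasure (empirical T x n) := by
  constructor
  have h : ∀ l : ℕ, Measure.dirac (T^[l] x) (Set.univ : Set X) = 1 := fun l => by
    simp [measure_univ]
  simp only [empirical, Measure.smul_apply, Measure.coe_finset_sum, Finset.sum_apply, h,
    Finset.sum_const, Finset.card_range, nsmul_eq_mul, mul_one, smul_eq_mul]
  rw [Nat.cast_add, Nat.cast_one, ENNReal.inv_mul_cancel] <;> simp [Nat.cast_add_one_ne_zero]

/-- The `n`-th empirical measure as a probability measure. -/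
def empiricalPM {X : Type*} [MeasurableSpace X] (T : X → X) (x : X) (n : ℕ) :
    ProbabilityMeasure X := ⟨empirical T x n, empirical_prob T x n⟩

/-- `V(x)`: the set of weak* accumulation points of the sequence of empirical measures of `x`. -/
def accPts {X : Type*} [MeasurableSpace X] [TopologicalSpace X] [OpensMeasurableSpace X]
    (T : X → X) (x : X) : Set (ProbabilityMeasure X) :=
  {μ | MapClusterPt μ atTop (fun n => empiricalPM T x n)}

/-- A probability measure is invariant for `T`. -/
def IsInvariantPM {X : Type*} [MeasurableSpace X] (T : X → X)
    (μ : ProbabilityMeasure X) : Prop :=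
  (μ : Measure X).map T = (μ : Measure X)

/-- Convexity of a set of probability measures. -/
def IsConvexPMSet {X : Type*} [MeasurableSpace X] (A : Set (ProbabilityMeasure X)) : Prop :=
  ∀ μ ∈ A, ∀ ν ∈ A, ∀ t : ℝ≥0, t ≤ 1 → ∀ ρ : ProbabilityMeasure X,
    (ρ : Measure X) = t • (μ : Measure X) + (1 - t) • (ν : Measure X) → ρ ∈ A

/-- The left shift. -/
def shiftMap {β : Type*} (ω : ℕ → β) : ℕ → β := fun n => ω (n + 1)

/-- The digit set `D = {(0,0), (1,1), (2,0)}` of the Bedford–McMullen carpet with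
`a₁ = 3`, `a₂ = 2`. -/
abbrev CarpetDigit : Type :=
  {v : ℕ × ℕ // v ∈ ({(0, 0), (1, 1), (2, 0)} : Finset (ℕ × ℕ))}

/-- The symbolic space `Σ = D^ℕ`. -/
abbrev CarpetSymb : Type := ℕ → CarpetDigit

/-- The coding map `Π : Σ → 𝕋²`, `ω ↦ (Σ i₁(ν) 3^{-ν}, Σ i₂(ν) 2^{-ν})`. -/
def carpetCoding (ω : CarpetSymb) : AddCircle (1 : ℝ) × AddCircle (1 : ℝ) :=
  (((∑' ν : ℕ, ((ω ν).1.1 : ℝ) / 3 ^ (ν + 1) : ℝ) : AddCircle (1 : ℝ)),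
   ((∑' ν : ℕ, ((ω ν).1.2 : ℝ) / 2 ^ (ν + 1) : ℝ) : AddCircle (1 : ℝ)))

/-- The Bedford–McMullen carpet `Λ`. -/
def carpet : Set (AddCircle (1 : ℝ) × AddCircle (1 : ℝ)) := Set.range carpetCoding

/-- The Birkhoff level set `E_φ(α) ⊆ Σ`. -/
def carpetLevel (φ : CarpetSymb → ℝ) (α : ℝ) : Set CarpetSymb :=
  {ω | Tendsto (fun n : ℕ =>
    (n : ℝ)⁻¹ * ∑ r ∈ Finset.range n, φ (shiftMap^[r] ω)) atTop (𝓝 α)}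

/-- The potential `φ(ω) = 1` if `ω₁ = (2,0)`, `φ(ω) = 0` otherwise. -/
def phiEx2 (ω : CarpetSymb) : ℝ := if (ω 0).1 = (2, 0) then 1 else 0

/-- The claimed value of the packing spectrum of Example 2. -/
def specEx2 (α : ℝ) : ℝ :=
  if α ≤ 1 / 2 then
    (Real.negMulLog α + Real.negMulLog (1 - α) - α * Real.log 2) / Real.log 3 + 1
  else
    (Real.negMulLog α + Real.negMulLog (1 - α)) / Real.log 2 +
      (1 - α) * (Real.log 2 / Real.log 3)

/-- The two-dimensional torus. -/
abbrev Torus2 : Type := AddCircle (1 : ℝ) × AddCircle (1 : ℝ)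

section Dimension

lemma coverN_le {X : Type*} [PseudoMetricSpace X] {s : Set X} {r : ℝ} (t : Finset X)
    (h : s ⊆ ⋃ x ∈ t, Metric.ball x r) : coverN s r ≤ t.card :=
  Nat.sInf_le ⟨t, rfl, h⟩

lemma exists_coverN {X : Type*} [PseudoMetricSpace X] [CompactSpace X] (s : Set X) {r : ℝ}
    (hr : 0 < r) : ∃ t : Finset X, t.card = coverN s r ∧ s ⊆ ⋃ x ∈ t, Metric.ball x r := by
  have : {n : ℕ | ∃ t : Finset X, t.card = n ∧ s ⊆ ⋃ x ∈ t, Metric.ball x r}.Nonempty := by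
    obtain ⟨t, -, ht, hc⟩ := (isCompact_univ (X := X)).finite_cover_balls hr
    refine ⟨_, ht.toFinset, rfl, fun x _ => ?_⟩
    simpa using hc (Set.mem_univ x)
  exact Nat.sInf_mem this

lemma exists_grid_near (x : AddCircle (1 : ℝ)) {M : ℕ} (hM : 0 < M) :
    ∃ j ∈ Finset.range M, dist x (((j : ℝ) / M : ℝ) : AddCircle (1 : ℝ)) < 2 / M := by
  obtain ⟨y, ⟨hy0, hy1⟩, rfl⟩ := AddCircle.eq_coe_Ico (p := (1 : ℝ)) x
  have hM' : (0 : ℝ) < M := by exact_mod_cast hM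
  refine ⟨⌊y * M⌋₊, ?_, ?_⟩
  · rw [Finset.mem_range, Nat.floor_lt (by positivity)]
    nlinarith
  · rw [dist_eq_norm, ← AddCircle.coe_sub]
    refine lt_of_le_of_lt (QuotientAddGroup.norm_mk_le_norm (S := AddSubgroup.zmultiples (1 : ℝ)))
      ?_
    have h1 := Nat.floor_le (a := y * M) (by positivity)
    have h2 := Nat.lt_floor_add_one (y * M)
    rw [Real.norm_eq_abs, abs_lt]
    constructor
    · have : (⌊y * M⌋₊ : ℝ) / M ≤ y := by rw [div_le_iff₀ hM']; exact h1
      have : 0 < 2 / (M : ℝ) := by positivity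
      linarith
    · rw [sub_lt_iff_lt_add, ← add_div, lt_div_iff₀ hM']
      linarith

lemma coverN_torus_le (s : Set Torus2) {M : ℕ} (hM : 0 < M) {r : ℝ} (hr : 2 / M ≤ r) :
    coverN s r ≤ M * M := by
  classical
  let g : ℕ × ℕ → Torus2 := fun p =>
    ((((p.1 : ℝ) / M : ℝ) : AddCircle (1 : ℝ)), (((p.2 : ℝ) / M : ℝ) : AddCircle (1 : ℝ)))
  refine (coverN_le ((Finset.range M ×ˢ Finset.range M).image g) ?_).trans ?_
  · intro x _
    obtain ⟨i, hi, hxi⟩ := exists_grid_near x.1 hM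
    obtain ⟨j, hj, hxj⟩ := exists_grid_near x.2 hM
    simp only [Set.mem_iUnion]
    refine ⟨g (i, j), Finset.mem_image_of_mem _ (Finset.mk_mem_product hi hj), ?_⟩
    rw [Metric.mem_ball, Prod.dist_eq]
    exact max_lt (hxi.trans_le hr) (hxj.trans_le hr)
  · refine Finset.card_image_le.trans ?_
    simp

lemma log_inv_pos {r : ℝ} (h0 : 0 < r) (h1 : r < 1) : 0 < Real.log r⁻¹ :=
  Real.log_pos ((one_lt_inv₀ h0).2 h1)

lemma eventually_small {c : ℝ} (hc : 0 < c) : ∀ᶠ r in 𝓝[>] (0 : ℝ), 0 < r ∧ r < c :=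
  Ioo_mem_nhdsGT hc

lemma coverRatio_nonneg {X : Type*} [PseudoMetricSpace X] (s : Set X) :
    ∀ᶠ r in 𝓝[>] (0 : ℝ), 0 ≤ Real.log (coverN s r) / Real.log r⁻¹ := by
  filter_upwards [eventually_small one_pos] with r hr
  exact div_nonneg (Real.log_natCast_nonneg _) (log_inv_pos hr.1 hr.2).le

lemma coverRatio_torus_le (s : Set Torus2) :
    ∀ᶠ r in 𝓝[>] (0 : ℝ), Real.log (coverN s r) / Real.log r⁻¹ ≤ 4 := by
  filter_upwards [eventually_small (show (0 : ℝ) < 1 / 3 by norm_num)] with r hr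
  have hpos := log_inv_pos hr.1 (hr.2.trans (by norm_num))
  rw [div_le_iff₀ hpos]
  rcases Nat.eq_zero_or_pos (coverN s r) with h | h
  · rw [h]; simp only [Nat.cast_zero, Real.log_zero]; positivity
  have hr' : 3 < r⁻¹ := by rw [lt_inv_comm₀ (by norm_num) hr.1]; linarith [hr.2]
  set M := ⌈2 * r⁻¹⌉₊ with hM
  have hM0 : 0 < M := Nat.ceil_pos.2 (by linarith)
  have hM1 : 2 * r⁻¹ ≤ M := Nat.le_ceil _
  have hM2 : (M : ℝ) < 2 * r⁻¹ + 1 := Nat.ceil_lt_add_one (by linarith)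
  have hc : coverN s r ≤ M * M := coverN_torus_le s hM0 (by
    rw [div_le_iff₀ (by exact_mod_cast hM0)]
    have := mul_le_mul_of_nonneg_left hM1 hr.1.le
    rw [mul_left_comm, mul_inv_cancel₀ hr.1.ne'] at this
    linarith)
  have hM3 : (M : ℝ) ≤ r⁻¹ ^ 2 := by nlinarith
  calc Real.log (coverN s r) ≤ Real.log (r⁻¹ ^ 4) := by
        refine Real.log_le_log (by exact_mod_cast h) ?_
        calc (coverN s r : ℝ) ≤ M * M := by exact_mod_cast hc
          _ ≤ r⁻¹ ^ 2 * r⁻¹ ^ 2 := by gcongr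
          _ = r⁻¹ ^ 4 := by ring
    _ = 4 * Real.log r⁻¹ := by rw [Real.log_pow]; norm_num

lemma upperBoxDim_le_of_eventually {X : Type*} [PseudoMetricSpace X] {s : Set X} {t : ℝ}
    (h : ∀ᶠ r in 𝓝[>] (0 : ℝ), Real.log (coverN s r) / Real.log r⁻¹ ≤ t) :
    upperBoxDim s ≤ t :=
  limsup_le_of_le (isCoboundedUnder_le_of_eventually_le _ (coverRatio_nonneg s)) h

lemma upperBoxDim_nonneg (s : Set Torus2) : 0 ≤ upperBoxDim s := by
  refine le_limsup_of_le ⟨4, coverRatio_torus_le s⟩ fun b hb => ?_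
  obtain ⟨r, h1, h2⟩ := ((coverRatio_nonneg s).and hb).exists
  exact h1.trans h2

lemma eventually_coverRatio_lt {s : Set Torus2} {t : ℝ} (h : upperBoxDim s < t) :
    ∀ᶠ r in 𝓝[>] (0 : ℝ), Real.log (coverN s r) / Real.log r⁻¹ < t :=
  eventually_lt_of_limsup_lt h ⟨4, coverRatio_torus_le s⟩

lemma bddAbove_upperBoxDim (C : ℕ → Set Torus2) :
    BddAbove (Set.range fun n => upperBoxDim (C n)) :=
  ⟨4, by rintro _ ⟨n, rfl⟩; exact upperBoxDim_le_of_eventually (coverRatio_torus_le _)⟩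

lemma bddBelow_iSup_upperBoxDim (s : Set Torus2) :
    BddBelow (Set.range fun C : {C : ℕ → Set Torus2 // s ⊆ ⋃ n, C n} =>
      ⨆ n, upperBoxDim (C.1 n)) :=
  ⟨0, by rintro _ ⟨C, rfl⟩; exact Real.iSup_nonneg fun n => upperBoxDim_nonneg _⟩

lemma packingDim_le {s : Set Torus2} {t : ℝ} (C : ℕ → Set Torus2) (hC : s ⊆ ⋃ n, C n)
    (h : ∀ n, upperBoxDim (C n) ≤ t) : packingDim s ≤ t :=
  (ciInf_le (bddBelow_iSup_upperBoxDim s) ⟨C, hC⟩).trans (ciSup_le h)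

instance nonempty_covers (s : Set Torus2) : Nonempty {C : ℕ → Set Torus2 // s ⊆ ⋃ n, C n} :=
  ⟨⟨fun _ => Set.univ, fun _ _ => Set.mem_iUnion.2 ⟨0, Set.mem_univ _⟩⟩⟩

lemma le_packingDim {s : Set Torus2} {t : ℝ}
    (h : ∀ C : ℕ → Set Torus2, s ⊆ ⋃ n, C n → ∃ n, t ≤ upperBoxDim (C n)) :
    t ≤ packingDim s :=
  le_ciInf fun C => by
    obtain ⟨n, hn⟩ := h C.1 C.2
    exact hn.trans (le_ciSup (bddAbove_upperBoxDim C.1) n)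

lemma packingDim_mono {s t : Set Torus2} (h : s ⊆ t) : packingDim s ≤ packingDim t :=
  le_ciInf fun C => ciInf_le (bddBelow_iSup_upperBoxDim s) ⟨C.1, h.trans C.2⟩

/-- A box dimension bound from covers at the dyadic scales `4 * 2 ^ (-n)`. -/
lemma upperBoxDim_le_of_dyadic {s : Set Torus2} {t : ℝ} (ht : 0 ≤ t) {N : ℕ}
    (h : ∀ n ≥ N, ∀ r : ℝ, 4 * (2 ^ n)⁻¹ ≤ r →
      (coverN s r : ℝ) ≤ Real.exp (n * (t * Real.log 2))) : upperBoxDim s ≤ t := by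
  have hl2 : 0 < Real.log 2 := Real.log_pos one_lt_two
  refine le_of_forall_pos_le_add fun δ hδ => upperBoxDim_le_of_eventually ?_
  have hc1 : (0 : ℝ) < (2 ^ N)⁻¹ := by positivity
  have hc2 : 0 < Real.exp (-(3 * t * Real.log 2 / δ)) := Real.exp_pos _
  filter_upwards [eventually_small one_pos, eventually_small hc1, eventually_small hc2]
    with r hr hrN hrδ
  have hpos := log_inv_pos hr.1 hr.2
  rw [div_le_iff₀ hpos]
  obtain ⟨m, hm1, hm2⟩ := exists_nat_pow_near (x := r⁻¹) (y := (2 : ℝ))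
    ((one_lt_inv₀ hr.1).2 hr.2).le one_lt_two
  have hmN : N ≤ m + 3 := by
    have h1 : (2 : ℝ) ^ N < 2 ^ (m + 1) := lt_of_lt_of_le
      ((lt_inv_comm₀ (by positivity) hr.1).2 hrN.2) hm2.le
    have := (pow_lt_pow_iff_right₀ one_lt_two).1 h1
    omega
  have hcov := h (m + 3) hmN r (by
    rw [← div_eq_mul_inv, div_le_iff₀ (by positivity)]
    have h1 : 1 < r * 2 ^ (m + 1) := by
      have := mul_lt_mul_of_pos_left hm2 hr.1
      rwa [mul_inv_cancel₀ hr.1.ne'] at this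
    have h2 : r * 2 ^ (m + 3) = 4 * (r * 2 ^ (m + 1)) := by ring
    rw [h2]; linarith)
  have hmlog : m * Real.log 2 ≤ Real.log r⁻¹ := by
    rw [← Real.log_pow]; exact Real.log_le_log (by positivity) hm1
  have hδ' : 3 * t * Real.log 2 ≤ δ * Real.log r⁻¹ := by
    have h1 := Real.log_lt_log hrδ.1 hrδ.2
    rw [Real.log_exp] at h1
    rw [Real.log_inv]
    have h2 : 3 * t * Real.log 2 / δ < -Real.log r := by linarith
    rw [div_lt_iff₀ hδ] at h2
    linarith
  have hfin : Real.log (coverN s r) ≤ (m + 3 : ℕ) * (t * Real.log 2) := by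
    rcases Nat.eq_zero_or_pos (coverN s r) with h0 | h0
    · rw [h0]; simp only [Nat.cast_zero, Real.log_zero]; positivity
    · rw [← Real.log_exp ((m + 3 : ℕ) * (t * Real.log 2))]
      exact Real.log_le_log (by exact_mod_cast h0) hcov
  push_cast at hfin
  nlinarith [mul_le_mul_of_nonneg_left hmlog ht]

end Dimension

section Geometry

/-- The integer with base `b` digits `a 0, …, a (n - 1)` (most significant first). -/
def prefixNat {b : ℕ} (a : ℕ → Fin b) : ℕ → ℕ
  | 0 => 0
  | n + 1 => b * prefixNat a n + a n

lemma prefixNat_lt {b : ℕ} (a : ℕ → Fin b) (n : ℕ) : prefixNat a n < b ^ n := by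
  induction n with
  | zero => simp [prefixNat]
  | succ n ih =>
    have h := (a n).2
    rw [prefixNat, pow_succ]
    nlinarith

lemma eq_of_prefixNat_eq {b : ℕ} {a a' : ℕ → Fin b} {n : ℕ}
    (h : prefixNat a n = prefixNat a' n) : ∀ i < n, a i = a' i := by
  induction n with
  | zero => intro i hi; omega
  | succ n ih =>
    have hb : 0 < b := Fin.pos (a 0)
    simp only [prefixNat] at h
    have h1 : (a n : ℕ) = a' n := by
      have := congrArg (· % b) h
      simpa [Nat.mul_add_mod, Nat.mod_eq_of_lt] using this
    rw [h1] at h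
    have h2 : prefixNat a n = prefixNat a' n :=
      Nat.eq_of_mul_eq_mul_left hb (Nat.add_right_cancel h)
    intro i hi
    rcases Nat.lt_succ_iff_lt_or_eq.1 hi with hi | rfl
    · exact ih h2 i hi
    · exact Fin.ext h1

lemma ofDigits_mul_pow {b : ℕ} (a : ℕ → Fin b) (n : ℕ) :
    ∃ θ ∈ Set.Icc (0 : ℝ) 1, Real.ofDigits a * b ^ n = prefixNat a n + θ := by
  have hb : (0 : ℝ) < b := by exact_mod_cast Fin.pos (a 0)
  refine ⟨_, ⟨Real.ofDigits_nonneg fun i => a (i + n), Real.ofDigits_le_one _⟩, ?_⟩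
  rw [Real.ofDigits_eq_sum_add_ofDigits a n, add_mul, mul_right_comm,
    inv_mul_cancel₀ (by positivity), one_mul, add_left_inj]
  induction n with
  | zero => simp [prefixNat]
  | succ n ih =>
    rw [Finset.sum_range_succ, add_mul, pow_succ, ← mul_assoc, ih, Real.ofDigitsTerm, prefixNat,
      pow_succ]
    push_cast
    field_simp

/-- The three elements of `ZMod m` adjacent or equal to a given one. -/
def nbrs {m : ℕ} (z : ZMod m) : Finset (ZMod m) := {z - 1, z, z + 1}

lemma prefixNat_mem_nbrs {b : ℕ} (a a' : ℕ → Fin b) (n : ℕ)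
    (h : dist ((Real.ofDigits a : ℝ) : AddCircle (1 : ℝ)) (Real.ofDigits a' : ℝ) <
      ((b : ℝ) ^ n)⁻¹) :
    (prefixNat a n : ZMod (b ^ n)) ∈ nbrs (prefixNat a' n : ZMod (b ^ n)) := by
  have hb : (0 : ℝ) < b := by exact_mod_cast Fin.pos (a 0)
  rw [dist_eq_norm, ← AddCircle.coe_sub, UnitAddCircle.norm_eq] at h
  set k : ℤ := round (Real.ofDigits a - Real.ofDigits a')
  obtain ⟨θ, hθ, h1⟩ := ofDigits_mul_pow a n
  obtain ⟨θ', hθ', h2⟩ := ofDigits_mul_pow a' n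
  have h3 : |((prefixNat a n : ℝ) + θ) - (prefixNat a' n + θ') - k * b ^ n| < 1 := by
    rw [← h1, ← h2, ← sub_mul, ← sub_mul, abs_mul, abs_of_pos (a := (b : ℝ) ^ n) (by positivity)]
    have h' := mul_lt_mul_of_pos_right h (show (0 : ℝ) < b ^ n by positivity)
    rwa [inv_mul_cancel₀ (by positivity)] at h'
  rw [abs_lt] at h3
  obtain ⟨h3, h4⟩ := h3
  obtain ⟨h5, h6⟩ := hθ
  obtain ⟨h7, h8⟩ := hθ'
  have h9 : (-2 : ℝ) < ((prefixNat a n - prefixNat a' n - k * b ^ n : ℤ) : ℝ) := by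
    push_cast; linarith
  have h10 : ((prefixNat a n - prefixNat a' n - k * b ^ n : ℤ) : ℝ) < 2 := by
    push_cast; linarith
  have h11 : (-2 : ℤ) < (prefixNat a n - prefixNat a' n - k * b ^ n : ℤ) := by exact_mod_cast h9
  have h12 : (prefixNat a n - prefixNat a' n - k * b ^ n : ℤ) < 2 := by exact_mod_cast h10
  have hz : ((b : ZMod (b ^ n)) ^ n) = 0 := by
    rw [← Nat.cast_pow]; exact ZMod.natCast_self _
  have key : ∀ e : ℤ, (prefixNat a n - prefixNat a' n - k * b ^ n : ℤ) = e →
      (prefixNat a n : ZMod (b ^ n)) = prefixNat a' n + (e : ZMod (b ^ n)) := by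
    intro e he
    have := congrArg (Int.cast : ℤ → ZMod (b ^ n)) he
    push_cast at this
    rw [hz, mul_zero, sub_zero] at this
    rw [← this]; ring
  simp only [nbrs, Finset.mem_insert, Finset.mem_singleton]
  have : (prefixNat a n - prefixNat a' n - k * b ^ n : ℤ) = -1 ∨
      (prefixNat a n - prefixNat a' n - k * b ^ n : ℤ) = 0 ∨
      (prefixNat a n - prefixNat a' n - k * b ^ n : ℤ) = 1 := by omega
  rcases this with h | h | h
  · left; rw [key _ h]; push_cast; ring
  · right; left; rw [key _ h]; push_cast; ring
  · right; right; rw [key _ h]; push_cast; ring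

lemma carpetDigit_bounds (d : CarpetDigit) : d.1.1 < 3 ∧ d.1.2 < 2 := by
  obtain ⟨v, hv⟩ := d
  simp only [Finset.mem_insert, Finset.mem_singleton] at hv
  rcases hv with rfl | rfl | rfl <;> simp

lemma carpetDigit_ext {d e : CarpetDigit} (h : d.1.1 = e.1.1) : d = e := by
  obtain ⟨v, hv⟩ := d
  obtain ⟨w, hw⟩ := e
  simp only [Finset.mem_insert, Finset.mem_singleton] at hv hw
  rcases hv with rfl | rfl | rfl <;> rcases hw with rfl | rfl | rfl <;> simp_all

/-- The base `3` digits of the first coordinate. -/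
def xDigits (ω : CarpetSymb) : ℕ → Fin 3 := fun i => ⟨(ω i).1.1, (carpetDigit_bounds _).1⟩

/-- The base `2` digits of the second coordinate. -/
def yDigits (ω : CarpetSymb) : ℕ → Fin 2 := fun i => ⟨(ω i).1.2, (carpetDigit_bounds _).2⟩

lemma carpetCoding_eq (ω : CarpetSymb) :
    carpetCoding ω = (((Real.ofDigits (xDigits ω) : ℝ) : AddCircle (1 : ℝ)),
      ((Real.ofDigits (yDigits ω) : ℝ) : AddCircle (1 : ℝ))) := by
  simp [carpetCoding, Real.ofDigits, Real.ofDigitsTerm, xDigits, yDigits, div_eq_mul_inv]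

/-- The number of base `3` digits matching `n` base `2` digits: `3 ^ L ≤ 2 ^ n < 3 ^ (L + 1)`. -/
def matchLen (n : ℕ) : ℕ := Nat.log 3 (2 ^ n)

lemma pow_matchLen_le (n : ℕ) : 3 ^ matchLen n ≤ 2 ^ n :=
  Nat.pow_log_le_self _ (by positivity)

lemma lt_pow_matchLen (n : ℕ) : 2 ^ n < 3 ^ (matchLen n + 1) :=
  Nat.lt_pow_succ_log_self (by norm_num) _

lemma matchLen_le (n : ℕ) : matchLen n ≤ n := by
  by_contra! h
  have h1 : 2 ^ n < 2 ^ matchLen n := Nat.pow_lt_pow_right (by norm_num) h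
  have h2 : 2 ^ matchLen n ≤ 3 ^ matchLen n := Nat.pow_le_pow_left (by norm_num) _
  exact absurd (pow_matchLen_le n) (by omega)

lemma matchLen_mono : Monotone matchLen := fun _ _ h =>
  Nat.log_mono_right (Nat.pow_le_pow_right (by norm_num) h)

/-- The set of codes lying in the same approximate square of level `n` as `ω`. -/
def cell (n : ℕ) (ω : CarpetSymb) : Set CarpetSymb :=
  {η | (∀ i < matchLen n, η i = ω i) ∧ ∀ i < n, (η i).1.2 = (ω i).1.2}

lemma dist_coe_le (x y : ℝ) : dist (x : AddCircle (1 : ℝ)) (y : AddCircle (1 : ℝ)) ≤ |x - y| := by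
  rw [dist_eq_norm, ← AddCircle.coe_sub]
  exact QuotientAddGroup.norm_mk_le_norm (S := AddSubgroup.zmultiples (1 : ℝ))

lemma dist_lt_of_mem_cell {n : ℕ} {ω η : CarpetSymb} (h : η ∈ cell n ω) :
    dist (carpetCoding η) (carpetCoding ω) < 4 * (2 ^ n)⁻¹ := by
  rw [carpetCoding_eq, carpetCoding_eq, Prod.dist_eq]
  have hpos : (0 : ℝ) < (2 ^ n)⁻¹ := by positivity
  refine max_lt ?_ ?_
  · refine (dist_coe_le _ _).trans_lt ?_
    refine (Real.abs_ofDigits_sub_ofDigits_le (n := matchLen n)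
      fun i hi => by simp [xDigits, h.1 i hi]).trans_lt ?_
    have h1 : (2 : ℝ) ^ n < 3 ^ matchLen n * 3 := by
      rw [← pow_succ]; exact_mod_cast lt_pow_matchLen n
    push_cast
    rw [← div_eq_mul_inv, inv_eq_one_div, div_lt_div_iff₀ (by positivity) (by positivity)]
    have h2 : (0 : ℝ) < 3 ^ matchLen n := by positivity
    linarith
  · refine (dist_coe_le _ _).trans_lt ?_
    refine (Real.abs_ofDigits_sub_ofDigits_le (n := n)
      fun i hi => by simp [yDigits, h.2 i hi]).trans_lt ?_
    push_cast
    linarith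

/-- The position of the approximate square of level `n` containing `ω`. -/
def cellKey (n : ℕ) (ω : CarpetSymb) : ZMod (3 ^ matchLen n) × ZMod (2 ^ n) :=
  (prefixNat (xDigits ω) (matchLen n), prefixNat (yDigits ω) n)

lemma natCast_zmod_inj {m a b : ℕ} (ha : a < m) (hb : b < m) (h : (a : ZMod m) = b) : a = b := by
  rw [ZMod.natCast_eq_natCast_iff] at h
  exact h.eq_of_lt_of_lt ha hb

lemma mem_cell_of_cellKey_eq {n : ℕ} {ω η : CarpetSymb} (h : cellKey n η = cellKey n ω) :
    η ∈ cell n ω := by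
  obtain ⟨h1, h2⟩ := Prod.ext_iff.1 h
  have h3 := eq_of_prefixNat_eq (natCast_zmod_inj (prefixNat_lt _ _) (prefixNat_lt _ _) h1)
  have h4 := eq_of_prefixNat_eq (natCast_zmod_inj (prefixNat_lt _ _) (prefixNat_lt _ _) h2)
  exact ⟨fun i hi => carpetDigit_ext (Fin.ext_iff.1 (h3 i hi)), fun i hi => Fin.ext_iff.1 (h4 i hi)⟩

lemma cellKey_mem_nbrs {n : ℕ} {ω η : CarpetSymb}
    (h : dist (carpetCoding η) (carpetCoding ω) < (2 ^ n)⁻¹) :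
    cellKey n η ∈ nbrs (cellKey n ω).1 ×ˢ nbrs (cellKey n ω).2 := by
  rw [carpetCoding_eq, carpetCoding_eq, Prod.dist_eq, max_lt_iff] at h
  refine Finset.mem_product.2 ⟨prefixNat_mem_nbrs _ _ _ (h.1.trans_le ?_),
    prefixNat_mem_nbrs _ _ _ (by exact_mod_cast h.2)⟩
  refine inv_anti₀ (by positivity) ?_
  exact_mod_cast pow_matchLen_le n

lemma card_nbrs_le {m : ℕ} (z : ZMod m) : (nbrs z).card ≤ 3 := Finset.card_le_three

lemma measure_le_of_cover {F : Set CarpetSymb} (μ : Measure CarpetSymb) {C : Set Torus2} {n : ℕ}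
    {r : ℝ} {c : ℝ≥0∞} (hr : 0 < r) (hrn : 2 * r ≤ (2 ^ n)⁻¹) (hFC : ∀ ω ∈ F, carpetCoding ω ∈ C)
    (hF : ∀ ω ∈ F, μ (cell n ω) ≤ c) : μ F ≤ coverN C r * (9 * c) := by
  obtain ⟨t, ht, hcov⟩ := exists_coverN C hr
  have hball : ∀ x : Torus2, μ {ω ∈ F | carpetCoding ω ∈ Metric.ball x r} ≤ 9 * c := by
    intro x
    rcases {ω ∈ F | carpetCoding ω ∈ Metric.ball x r}.eq_empty_or_nonempty with h | ⟨ω₀, -, h₀⟩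
    · rw [h]; simp
    set K := nbrs (cellKey n ω₀).1 ×ˢ nbrs (cellKey n ω₀).2 with hK
    have hsub : {ω ∈ F | carpetCoding ω ∈ Metric.ball x r} ⊆
        ⋃ k ∈ K, {ω ∈ F | cellKey n ω = k} := by
      rintro ω ⟨hω, hωx⟩
      refine Set.mem_biUnion (cellKey_mem_nbrs ?_) ⟨hω, rfl⟩
      calc _ ≤ dist (carpetCoding ω) x + dist (carpetCoding ω₀) x := dist_triangle_right _ _ _
        _ < r + r := add_lt_add hωx h₀
        _ ≤ _ := by linarith
    have hk : ∀ k ∈ K, μ {ω ∈ F | cellKey n ω = k} ≤ c := by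
      intro k _
      rcases {ω ∈ F | cellKey n ω = k}.eq_empty_or_nonempty with h | ⟨ω₁, h₁, h₁'⟩
      · rw [h]; simp
      · refine (measure_mono ?_).trans (hF ω₁ h₁)
        rintro ω ⟨-, hω⟩
        exact mem_cell_of_cellKey_eq (hω.trans h₁'.symm)
    calc _ ≤ _ := measure_mono hsub
      _ ≤ ∑ k ∈ K, μ {ω ∈ F | cellKey n ω = k} := measure_biUnion_finset_le _ _
      _ ≤ ∑ k ∈ K, c := Finset.sum_le_sum hk
      _ = K.card * c := by simp
      _ ≤ 9 * c := by
        gcongr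
        have : K.card ≤ 9 := by
          rw [hK, Finset.card_product]
          exact Nat.mul_le_mul (card_nbrs_le _) (card_nbrs_le _)
        exact_mod_cast this
  have hsub : F ⊆ ⋃ x ∈ t, {ω ∈ F | carpetCoding ω ∈ Metric.ball x r} := by
    intro ω hω
    obtain ⟨x, hx, hωx⟩ := Set.mem_iUnion₂.1 (hcov (hFC ω hω))
    exact Set.mem_biUnion hx ⟨hω, hωx⟩
  calc _ ≤ _ := measure_mono hsub
    _ ≤ ∑ x ∈ t, μ {ω ∈ F | carpetCoding ω ∈ Metric.ball x r} := measure_biUnion_finset_le _ _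
    _ ≤ ∑ x ∈ t, 9 * c := Finset.sum_le_sum fun x _ => hball x
    _ = _ := by simp [ht]

end Geometry

section UpperBound

/-- Indicator of the digit `(2, 0)`. -/
def hit (d : CarpetDigit) : ℝ := if d.1 = (2, 0) then 1 else 0

/-- The number of occurrences of `(2, 0)` among the first `n` digits. -/
def hitCount (n : ℕ) (ω : CarpetSymb) : ℝ := ∑ i ∈ Finset.range n, hit (ω i)

lemma shiftMap_iterate_zero (r : ℕ) (ω : CarpetSymb) : shiftMap^[r] ω 0 = ω r := by
  have : ∀ (r k : ℕ) (ω : CarpetSymb), shiftMap^[r] ω k = ω (r + k) := by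
    intro r
    induction r with
    | zero => intro k ω; simp
    | succ r ih =>
      intro k ω
      rw [Function.iterate_succ_apply, ih, shiftMap]
      congr 1; omega
  simpa using this r 0 ω

lemma mem_carpetLevel {α : ℝ} {ω : CarpetSymb} :
    ω ∈ carpetLevel phiEx2 α ↔ Tendsto (fun n : ℕ => hitCount n ω / n) atTop (𝓝 α) := by
  simp only [carpetLevel, Set.mem_ofPred_eq, phiEx2, shiftMap_iterate_zero, hitCount, hit,
    div_eq_inv_mul]

lemma hit_nonneg (d : CarpetDigit) : 0 ≤ hit d := by unfold hit; split_ifs <;> norm_num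

lemma hit_le_one (d : CarpetDigit) : hit d ≤ 1 := by unfold hit; split_ifs <;> norm_num

/-- The logarithm of the mass given to an approximate square of level `n` by the product measure
with digit frequency `β` up to `matchLen n` and row frequency `γ` afterwards. -/
def logMass (β γ : ℝ) (n : ℕ) (ω : CarpetSymb) : ℝ :=
  (hitCount (matchLen n) ω * Real.log β +
    (matchLen n - hitCount (matchLen n) ω) * Real.log ((1 - β) / 2)) +
  ((hitCount n ω - hitCount (matchLen n) ω) * Real.log γ +
    ((n - matchLen n) - (hitCount n ω - hitCount (matchLen n) ω)) * Real.log (1 - γ))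

lemma sum_Ico_hit (ω : CarpetSymb) {m n : ℕ} (h : m ≤ n) (a b : ℝ) :
    ∑ i ∈ Finset.Ico m n, (hit (ω i) * a + (1 - hit (ω i)) * b) =
      (hitCount n ω - hitCount m ω) * a + ((n - m) - (hitCount n ω - hitCount m ω)) * b := by
  rw [hitCount, hitCount, ← Finset.sum_Ico_eq_sub _ h, Finset.sum_add_distrib, ← Finset.sum_mul,
    ← Finset.sum_mul, Finset.sum_sub_distrib]
  simp [Nat.cast_sub h]

lemma logMass_eq_sum (β γ : ℝ) (n : ℕ) (ω : CarpetSymb) :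
    logMass β γ n ω = ∑ i ∈ Finset.range n, if i < matchLen n then
      hit (ω i) * Real.log β + (1 - hit (ω i)) * Real.log ((1 - β) / 2) else
      hit (ω i) * Real.log γ + (1 - hit (ω i)) * Real.log (1 - γ) := by
  rw [Finset.range_eq_Ico, ← Finset.sum_Ico_consecutive _ (Nat.zero_le _) (matchLen_le n)]
  rw [Finset.sum_congr rfl fun i hi => if_pos (Finset.mem_Ico.1 hi).2]
  rw [Finset.sum_congr rfl fun i hi => if_neg (not_lt.2 (Finset.mem_Ico.1 hi).1)]
  rw [sum_Ico_hit _ (Nat.zero_le _), sum_Ico_hit _ (matchLen_le n), logMass]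
  simp [hitCount]

/-- The digit `(0, 0)`. -/
def digit00 : CarpetDigit := ⟨(0, 0), by simp⟩

/-- The digits of `ω` up to `matchLen n`, followed by its rows up to `n`. -/
def cellCode (n : ℕ) (ω : CarpetSymb) (i : Fin n) : CarpetDigit :=
  if (i : ℕ) < matchLen n then ω i else if (ω i).1 = (2, 0) then digit00 else ω i

lemma mem_cell_of_cellCode_eq {n : ℕ} {ω η : CarpetSymb} (h : cellCode n η = cellCode n ω) :
    η ∈ cell n ω := by
  have h1 : ∀ i < matchLen n, η i = ω i := fun i hi => by
    simpa [cellCode, hi] using congrFun h ⟨i, hi.trans_le (matchLen_le n)⟩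
  have hrow : ∀ (ξ : CarpetSymb) (i : Fin n), (cellCode n ξ i).1.2 = (ξ i).1.2 := by
    intro ξ i
    unfold cellCode
    split_ifs with h1 h2
    · rfl
    · simp [digit00, h2]
    · rfl
  refine ⟨h1, fun i hi => ?_⟩
  have := hrow η ⟨i, hi⟩
  rw [h, hrow ω ⟨i, hi⟩] at this
  exact this.symm

/-- One-digit weights of the comparison measure. -/
def cellWeight (β γ : ℝ) (l i : ℕ) (v : ℕ × ℕ) : ℝ :=
  if i < l then (if v = (2, 0) then β else (1 - β) / 2)
  else if v = (2, 0) then 0 else if v = (0, 0) then γ else 1 - γ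

lemma sum_cellWeight (β γ : ℝ) (l i : ℕ) : ∑ d : CarpetDigit, cellWeight β γ l i d.1 = 1 := by
  rw [Finset.sum_coe_sort ({(0, 0), (1, 1), (2, 0)} : Finset (ℕ × ℕ)) (cellWeight β γ l i)]
  unfold cellWeight
  split_ifs <;> simp <;> ring

lemma cellWeight_nonneg {β γ : ℝ} (hβ : β ∈ Set.Ioo (0 : ℝ) 1) (hγ : γ ∈ Set.Ico (1 / 2 : ℝ) 1)
    (l i : ℕ) (v : ℕ × ℕ) : 0 ≤ cellWeight β γ l i v := by
  obtain ⟨h1, h2⟩ := hβ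
  obtain ⟨h3, h4⟩ := hγ
  unfold cellWeight
  split_ifs <;> linarith

lemma exp_logMass_le {β γ : ℝ} (hβ : β ∈ Set.Ioo (0 : ℝ) 1) (hγ : γ ∈ Set.Ico (1 / 2 : ℝ) 1)
    (n : ℕ) (ω : CarpetSymb) :
    Real.exp (logMass β γ n ω) ≤ ∏ i : Fin n, cellWeight β γ (matchLen n) i (cellCode n ω i).1 := by
  obtain ⟨h1, h2⟩ := hβ
  obtain ⟨h3, h4⟩ := hγ
  rw [logMass_eq_sum, Finset.sum_range, Real.exp_sum]
  refine Finset.prod_le_prod (fun _ _ => (Real.exp_pos _).le) fun i _ => ?_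
  by_cases hi : (i : ℕ) < matchLen n
  · by_cases hd : (ω i).1 = (2, 0)
    · simp [cellWeight, cellCode, hi, hd, hit, Real.exp_log h1]
    · simp [cellWeight, cellCode, hi, hd, hit,
        Real.exp_log (show 0 < (1 - β) / 2 by linarith)]
  · by_cases hd : (ω i).1 = (2, 0)
    · simp [cellWeight, cellCode, hi, hd, hit, digit00, Real.exp_log (show 0 < γ by linarith)]
    · by_cases hd0 : (ω i).1 = (0, 0)
      · simp [cellWeight, cellCode, hi, hd0, hit,
          Real.exp_log (show 0 < 1 - γ by linarith)]
        linarith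
      · simp [cellWeight, cellCode, hi, hd, hd0, hit,
          Real.exp_log (show 0 < 1 - γ by linarith)]

lemma coverN_image_le {β γ : ℝ} (hβ : β ∈ Set.Ioo (0 : ℝ) 1) (hγ : γ ∈ Set.Ico (1 / 2 : ℝ) 1)
    {F : Set CarpetSymb} {n : ℕ} {x r : ℝ} (hr : 4 * (2 ^ n)⁻¹ ≤ r)
    (hF : ∀ ω ∈ F, -x ≤ logMass β γ n ω) :
    (coverN (carpetCoding '' F) r : ℝ) ≤ Real.exp x := by
  classical
  set T : Finset (Fin n → CarpetDigit) := (Set.toFinite (cellCode n '' F)).toFinset with hT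
  have hmem : ∀ c, c ∈ T ↔ ∃ ω ∈ F, cellCode n ω = c := fun c => by simp [hT]
  have hcard : (T.card : ℝ) ≤ Real.exp x := by
    have h1 : ∑ c ∈ T, Real.exp (-x) ≤ 1 := by
      calc ∑ c ∈ T, Real.exp (-x)
          ≤ ∑ c ∈ T, ∏ i : Fin n, cellWeight β γ (matchLen n) i (c i).1 := by
            refine Finset.sum_le_sum fun c hc => ?_
            obtain ⟨ω, hω, rfl⟩ := (hmem c).1 hc
            exact (Real.exp_le_exp.2 (hF ω hω)).trans (exp_logMass_le hβ hγ n ω)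
        _ ≤ ∑ c : Fin n → CarpetDigit, ∏ i : Fin n, cellWeight β γ (matchLen n) i (c i).1 :=
            Finset.sum_le_sum_of_subset_of_nonneg (Finset.subset_univ _) fun c _ _ =>
              Finset.prod_nonneg fun i _ => cellWeight_nonneg hβ hγ _ _ _
        _ = ∏ i : Fin n, ∑ d : CarpetDigit, cellWeight β γ (matchLen n) i d.1 := by
            rw [Finset.prod_univ_sum, Fintype.piFinset_univ]
        _ = 1 := by simp only [sum_cellWeight, Finset.prod_const_one]
    rw [Finset.sum_const, nsmul_eq_mul, Real.exp_neg, ← div_eq_mul_inv,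
      div_le_one (Real.exp_pos _)] at h1
    exact h1
  have hrep : ∀ c : Fin n → CarpetDigit, ∃ ω, c ∈ T → cellCode n ω = c := by
    intro c
    by_cases hc : c ∈ T
    · obtain ⟨ω, -, h⟩ := (hmem c).1 hc
      exact ⟨ω, fun _ => h⟩
    · exact ⟨fun _ => digit00, fun h => absurd h hc⟩
  choose rep hrep using hrep
  refine le_trans ?_ hcard
  have : coverN (carpetCoding '' F) r ≤ (T.image fun c => carpetCoding (rep c)).card := by
    refine coverN_le _ ?_
    rintro _ ⟨ω, hω, rfl⟩
    have hc : cellCode n ω ∈ T := (hmem _).2 ⟨ω, hω, rfl⟩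
    simp only [Set.mem_iUnion]
    refine ⟨_, Finset.mem_image_of_mem _ hc, ?_⟩
    exact (dist_lt_of_mem_cell (mem_cell_of_cellCode_eq (hrep _ hc).symm)).trans_le hr
  exact_mod_cast this.trans Finset.card_image_le

lemma packingDim_image_le {β γ : ℝ} (hβ : β ∈ Set.Ioo (0 : ℝ) 1)
    (hγ : γ ∈ Set.Ico (1 / 2 : ℝ) 1) {E : Set CarpetSymb} {s : ℝ} (hs : 0 ≤ s)
    (hE : ∀ ω ∈ E, Tendsto (fun n : ℕ => logMass β γ n ω / n) atTop (𝓝 (-(s * Real.log 2)))) :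
    packingDim (carpetCoding '' E) ≤ s := by
  have hl2 : 0 < Real.log 2 := Real.log_pos one_lt_two
  refine le_of_forall_gt_imp_ge_of_dense fun t hst => ?_
  set F : ℕ → Set CarpetSymb := fun N =>
    {ω | ∀ n ≥ N, -(n * (t * Real.log 2)) ≤ logMass β γ n ω}
  refine packingDim_le (fun N => carpetCoding '' F N) ?_ fun N => ?_
  · rw [← Set.image_iUnion]
    refine Set.image_mono fun ω hω => ?_
    have h1 : -(t * Real.log 2) < -(s * Real.log 2) :=
      neg_lt_neg (mul_lt_mul_of_pos_right hst hl2)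
    obtain ⟨N, hN⟩ := eventually_atTop.1
      (((hE ω hω).eventually (lt_mem_nhds h1)).and (eventually_gt_atTop 0))
    refine Set.mem_iUnion.2 ⟨N, fun n hn => ?_⟩
    obtain ⟨h2, h3⟩ := hN n hn
    rw [lt_div_iff₀ (by exact_mod_cast h3)] at h2
    linarith
  · refine upperBoxDim_le_of_dyadic (hs.trans hst.le) (N := N) fun n hn r hr => ?_
    exact coverN_image_le hβ hγ hr fun ω hω => hω n hn

lemma tendsto_matchLen_div :
    Tendsto (fun n : ℕ => (matchLen n : ℝ) / n) atTop (𝓝 (Real.log 2 / Real.log 3)) := by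
  have hl3 : 0 < Real.log 3 := Real.log_pos (by norm_num)
  have hlow : Tendsto (fun n : ℕ => Real.log 2 / Real.log 3 - 1 / (n : ℝ)) atTop
      (𝓝 (Real.log 2 / Real.log 3)) := by
    simpa using tendsto_const_nhds.sub (tendsto_one_div_atTop_nhds_zero_nat (𝕜 := ℝ))
  refine tendsto_of_tendsto_of_tendsto_of_le_of_le' hlow tendsto_const_nhds ?_ ?_
  · filter_upwards [eventually_gt_atTop 0] with n hn
    have hn' : (0 : ℝ) < n := by exact_mod_cast hn
    have h1 : Real.log ((2 : ℝ) ^ n) ≤ Real.log (3 ^ (matchLen n + 1)) :=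
      Real.log_le_log (by positivity) (by exact_mod_cast (lt_pow_matchLen n).le)
    rw [Real.log_pow, Real.log_pow] at h1
    push_cast at h1
    rw [div_sub_div _ _ hl3.ne' hn'.ne', div_le_div_iff₀ (by positivity) hn']
    nlinarith
  · filter_upwards [eventually_gt_atTop 0] with n hn
    have hn' : (0 : ℝ) < n := by exact_mod_cast hn
    have h1 : Real.log ((3 : ℝ) ^ matchLen n) ≤ Real.log (2 ^ n) :=
      Real.log_le_log (by positivity) (by exact_mod_cast pow_matchLen_le n)
    rw [Real.log_pow, Real.log_pow] at h1
    rw [div_le_div_iff₀ hn' hl3]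
    linarith

lemma tendsto_matchLen : Tendsto matchLen atTop atTop := by
  refine tendsto_atTop.2 fun k => ?_
  filter_upwards [eventually_ge_atTop (2 * k)] with n hn
  refine (Nat.le_log_iff_pow_le (by norm_num) (by positivity)).2 ?_
  calc 3 ^ k ≤ 4 ^ k := Nat.pow_le_pow_left (by norm_num) _
    _ = 2 ^ (2 * k) := by rw [pow_mul]; norm_num
    _ ≤ 2 ^ n := Nat.pow_le_pow_right (by norm_num) hn

lemma tendsto_hitCount_matchLen {α : ℝ} {ω : CarpetSymb} (h : ω ∈ carpetLevel phiEx2 α) :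
    Tendsto (fun n : ℕ => hitCount (matchLen n) ω / n) atTop
      (𝓝 (Real.log 2 / Real.log 3 * α)) := by
  rw [mem_carpetLevel] at h
  refine (tendsto_matchLen_div.mul (h.comp tendsto_matchLen)).congr' ?_
  filter_upwards [tendsto_matchLen.eventually_gt_atTop 0] with n hn
  have hn' : (matchLen n : ℝ) ≠ 0 := by exact_mod_cast hn.ne'
  simp only [Function.comp]
  rw [div_mul_div_comm, mul_comm (n : ℝ), mul_div_mul_left _ _ hn']

/-- The asymptotic exponential decay rate of `logMass` on the level set of `α`. -/
def massRate (α β γ : ℝ) : ℝ :=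
  -(Real.log 2 / Real.log 3 * (α * Real.log β + (1 - α) * Real.log ((1 - β) / 2)) +
    (1 - Real.log 2 / Real.log 3) * (α * Real.log γ + (1 - α) * Real.log (1 - γ)))

lemma tendsto_logMass {α : ℝ} {ω : CarpetSymb} (h : ω ∈ carpetLevel phiEx2 α) (β γ : ℝ) :
    Tendsto (fun n : ℕ => logMass β γ n ω / n) atTop (𝓝 (-massRate α β γ)) := by
  have h1 := tendsto_hitCount_matchLen h
  have h2 := mem_carpetLevel.1 h
  have h3 := tendsto_matchLen_div
  have h4 : Tendsto (fun n : ℕ => (n : ℝ) / n) atTop (𝓝 1) := by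
    refine tendsto_const_nhds.congr' ?_
    filter_upwards [eventually_gt_atTop 0] with n hn
    rw [div_self (by exact_mod_cast hn.ne')]
  have := ((h1.mul_const (Real.log β)).add ((h3.sub h1).mul_const (Real.log ((1 - β) / 2)))).add
    (((h2.sub h1).mul_const (Real.log γ)).add
      (((h4.sub h3).sub (h2.sub h1)).mul_const (Real.log (1 - γ))))
  refine (this.congr fun n => ?_).trans_eq ?_
  · unfold logMass; ring
  · unfold massRate; congr 1; ring

end UpperBound

section LowerBound

/-- The digit `(1, 1)`. -/
def digit11 : CarpetDigit := ⟨(1, 1), by simp⟩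

/-- The digit `(2, 0)`. -/
def digit20 : CarpetDigit := ⟨(2, 0), by simp⟩

lemma carpetDigit_cases (d : CarpetDigit) : d = digit00 ∨ d = digit11 ∨ d = digit20 := by
  obtain ⟨v, hv⟩ := d
  simp only [Finset.mem_insert, Finset.mem_singleton] at hv
  rcases hv with rfl | rfl | rfl <;> simp [digit00, digit11, digit20]

/-- The measure on digits with weights `p, q, r` at `(0, 0), (1, 1), (2, 0)`. -/
def digitMeasure (p q r : ℝ) : Measure CarpetDigit :=
  ENNReal.ofReal p • Measure.dirac digit00 + ENNReal.ofReal q • Measure.dirac digit11 +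
    ENNReal.ofReal r • Measure.dirac digit20

lemma digitMeasure_apply (p q r : ℝ) (S : Set CarpetDigit) :
    digitMeasure p q r S = ENNReal.ofReal p * S.indicator 1 digit00 +
      ENNReal.ofReal q * S.indicator 1 digit11 + ENNReal.ofReal r * S.indicator 1 digit20 := by
  simp [digitMeasure, Measure.dirac_apply]

lemma isProbabilityMeasure_digitMeasure {p q r : ℝ} (hp : 0 ≤ p) (hq : 0 ≤ q) (hr : 0 ≤ r)
    (h : p + q + r = 1) : IsProbabilityMeasure (digitMeasure p q r) := by
  constructor
  simp [digitMeasure_apply, ← ENNReal.ofReal_add, hp, hq, hr, add_nonneg, h]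

lemma map_hit_digitMeasure {p q r : ℝ} (hp : 0 ≤ p) (hq : 0 ≤ q) :
    (digitMeasure p q r).map hit =
      ENNReal.ofReal (p + q) • Measure.dirac 0 + ENNReal.ofReal r • Measure.dirac 1 := by
  have hm : Measurable hit := measurable_of_countable _
  rw [digitMeasure, Measure.map_add _ _ hm, Measure.map_add _ _ hm, Measure.map_smul,
    Measure.map_smul, Measure.map_smul, Measure.map_dirac' hm, Measure.map_dirac' hm,
    Measure.map_dirac' hm, ENNReal.ofReal_add hp hq, add_smul]
  simp [hit, digit00, digit11, digit20]

/-- The frequency of the row `0` maximising the row entropy. -/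
def rowFreq (α : ℝ) : ℝ := max α (1 / 2)

/-- The positions at which only the row entropy counts, for the scales `n = j!`. -/
def rowBlock : Set ℕ := {i | ∃ j : ℕ, matchLen j.factorial ≤ i ∧ i < j.factorial}

open Classical in
/-- The distribution of the `i`-th digit: maximal row entropy in `rowBlock`, maximal entropy
elsewhere, always with frequency `α` of `(2, 0)`. -/
def blockMeasure (α : ℝ) (i : ℕ) : Measure CarpetDigit :=
  if i ∈ rowBlock then digitMeasure (rowFreq α - α) (1 - rowFreq α) α
  else digitMeasure ((1 - α) / 2) ((1 - α) / 2) α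

lemma le_rowFreq (α : ℝ) : α ≤ rowFreq α := le_max_left _ _

lemma half_le_rowFreq (α : ℝ) : 1 / 2 ≤ rowFreq α := le_max_right _ _

lemma rowFreq_le_one {α : ℝ} (h : α ≤ 1) : rowFreq α ≤ 1 := max_le h (by norm_num)

lemma isProbabilityMeasure_blockMeasure {α : ℝ} (hα : α ∈ Set.Icc (0 : ℝ) 1) (i : ℕ) :
    IsProbabilityMeasure (blockMeasure α i) := by
  have h1 := le_rowFreq α
  have h2 := rowFreq_le_one hα.2
  have h3 := hα.1
  have h4 := hα.2
  unfold blockMeasure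
  split_ifs
  · exact isProbabilityMeasure_digitMeasure (by linarith) (by linarith) h3 (by ring)
  · exact isProbabilityMeasure_digitMeasure (by linarith) (by linarith) h3 (by ring)

lemma map_hit_blockMeasure {α : ℝ} (hα : α ∈ Set.Icc (0 : ℝ) 1) (i : ℕ) :
    (blockMeasure α i).map hit =
      ENNReal.ofReal (1 - α) • Measure.dirac 0 + ENNReal.ofReal α • Measure.dirac 1 := by
  have h1 := le_rowFreq α
  have h2 := rowFreq_le_one hα.2
  have h4 := hα.2
  unfold blockMeasure
  split_ifs
  · rw [map_hit_digitMeasure (by linarith) (by linarith)]; congr 3; ring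
  · rw [map_hit_digitMeasure (by linarith) (by linarith)]; congr 3; ring

lemma ae_mem_carpetLevel {α : ℝ} (hα : α ∈ Set.Icc (0 : ℝ) 1) :
    ∀ᵐ ω ∂Measure.infinitePi (blockMeasure α), ω ∈ carpetLevel phiEx2 α := by
  have := isProbabilityMeasure_blockMeasure hα
  have hm : Measurable hit := measurable_of_countable _
  have hmi : ∀ i : ℕ, Measurable fun ω : CarpetSymb => hit (ω i) := fun i =>
    hm.comp (measurable_pi_apply i)
  have hmap : ∀ i, (Measure.infinitePi (blockMeasure α)).map (fun ω : CarpetSymb => hit (ω i)) =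
      ENNReal.ofReal (1 - α) • Measure.dirac 0 + ENNReal.ofReal α • Measure.dirac 1 := by
    intro i
    rw [← map_hit_blockMeasure hα i,
      ← (measurePreserving_eval_infinitePi (blockMeasure α) i).map_eq,
      Measure.map_map hm (measurable_pi_apply i)]
    rfl
  have hint : Integrable (fun ω : CarpetSymb => hit (ω 0))
      (Measure.infinitePi (blockMeasure α)) := by
    refine Integrable.of_bound (hmi 0).aestronglyMeasurable 1 (ae_of_all _ fun ω => ?_)
    rw [Real.norm_of_nonneg (hit_nonneg _)]
    exact hit_le_one _
  have key := ProbabilityTheory.strong_law_ae_real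
    (μ := Measure.infinitePi (blockMeasure α)) (fun i ω => hit (ω i)) hint
    (fun i j hij => (ProbabilityTheory.iIndepFun_infinitePi (P := blockMeasure α)
      (X := fun _ => hit) fun _ => hm).indepFun hij)
    (fun i => ⟨(hmi i).aemeasurable, (hmi 0).aemeasurable, by rw [hmap, hmap]⟩)
  have hmean : ∫ ω, hit (ω 0) ∂Measure.infinitePi (blockMeasure α) = α := by
    have h1 := integral_map (μ := Measure.infinitePi (blockMeasure α)) (hmi 0).aemeasurable
      (f := fun x : ℝ => x) aestronglyMeasurable_id
    rw [← h1, hmap, integral_add_measure, integral_smul_measure, integral_smul_measure]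
    · simp [hα.1]
    · exact (integrable_dirac (by simp)).smul_measure ENNReal.ofReal_ne_top
    · exact (integrable_dirac (by simp)).smul_measure ENNReal.ofReal_ne_top
  filter_upwards [key] with ω hω
  rw [mem_carpetLevel]
  rw [hmean] at hω
  exact hω

lemma ae_ne_digit00 {α : ℝ} (hα : α ∈ Set.Icc (0 : ℝ) 1) (h : rowFreq α = α) :
    ∀ᵐ ω ∂Measure.infinitePi (blockMeasure α), ∀ i ∈ rowBlock, ω i ≠ digit00 := by
  have := isProbabilityMeasure_blockMeasure hα
  rw [ae_all_iff]
  intro i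
  by_cases hi : i ∈ rowBlock
  · have hz : blockMeasure α i {digit00} = 0 := by
      simp [blockMeasure, hi, digitMeasure_apply, h, digit00, digit11, digit20]
    rw [← (measurePreserving_eval_infinitePi (blockMeasure α) i).measure_preimage
      (MeasurableSet.singleton _).nullMeasurableSet] at hz
    have : ∀ᵐ ω ∂Measure.infinitePi (blockMeasure α),
        ω ∉ Function.eval i ⁻¹' ({digit00} : Set CarpetDigit) := measure_eq_zero_iff_ae_notMem.1 hz
    filter_upwards [this] with ω hω _
    simpa using hω
  · exact ae_of_all _ fun ω h => absurd h hi

lemma mem_rowBlock {j i : ℕ} (h1 : matchLen j.factorial ≤ i) (h2 : i < j.factorial) :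
    i ∈ rowBlock := ⟨j, h1, h2⟩

lemma notMem_rowBlock {j i : ℕ} (h1 : j.factorial ≤ i) (h2 : i < matchLen (j + 1).factorial) :
    i ∉ rowBlock := by
  rintro ⟨k, hk1, hk2⟩
  rcases le_or_gt k j with h | h
  · exact absurd (Nat.factorial_le h) (by omega)
  · exact absurd (matchLen_mono (Nat.factorial_le (show j + 1 ≤ k from h))) (by omega)

lemma factorial_le_matchLen {j : ℕ} (hj : 1 ≤ j) :
    j.factorial ≤ matchLen (j + 1).factorial := by
  refine (Nat.le_log_iff_pow_le (by norm_num) (by positivity)).2 ?_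
  calc 3 ^ j.factorial ≤ 4 ^ j.factorial := Nat.pow_le_pow_left (by norm_num) _
    _ = 2 ^ (2 * j.factorial) := by rw [pow_mul]; norm_num
    _ ≤ 2 ^ (j + 1).factorial := Nat.pow_le_pow_right (by norm_num) (by
        rw [Nat.factorial_succ]; exact Nat.mul_le_mul_right _ (by omega))

lemma ofReal_le_ofReal_exp_log (x : ℝ) :
    ENNReal.ofReal x ≤ ENNReal.ofReal (Real.exp (Real.log x)) :=
  ENNReal.ofReal_le_ofReal (Real.le_exp_log x)

lemma blockMeasure_singleton_le {α : ℝ} {i : ℕ} (hi : i ∉ rowBlock) (d : CarpetDigit) :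
    blockMeasure α i {d} ≤ ENNReal.ofReal (Real.exp
      (hit d * Real.log α + (1 - hit d) * Real.log ((1 - α) / 2))) := by
  rcases carpetDigit_cases d with rfl | rfl | rfl <;>
  simp [blockMeasure, hi, digitMeasure_apply, digit00, digit11, digit20, hit,
    ENNReal.ofReal_le_ofReal, Real.le_exp_log]

lemma blockMeasure_row_le {α : ℝ} {i : ℕ} (hα : α ∈ Set.Icc (0 : ℝ) 1) (hi : i ∈ rowBlock)
    {d : CarpetDigit} (hd : rowFreq α = α → d ≠ digit00) :
    blockMeasure α i {e | e.1.2 = d.1.2} ≤ ENNReal.ofReal (Real.exp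
      (hit d * Real.log (rowFreq α) + (1 - hit d) * Real.log (1 - rowFreq α))) := by
  have hsum : ENNReal.ofReal (rowFreq α - α) + ENNReal.ofReal α = ENNReal.ofReal (rowFreq α) := by
    rw [← ENNReal.ofReal_add (sub_nonneg.2 (le_rowFreq α)) hα.1, sub_add_cancel]
  rcases carpetDigit_cases d with rfl | rfl | rfl
  · have hγ : rowFreq α = 1 - rowFreq α := by
      have hne : rowFreq α ≠ α := fun h => hd h rfl
      have : rowFreq α = 1 / 2 := (max_choice α (1 / 2)).resolve_left hne
      rw [this]; norm_num
    simp only [blockMeasure, hi, digitMeasure_apply, digit00, digit11, digit20, hit, if_true]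
    simp [hsum]
    rw [← hγ]
    exact ofReal_le_ofReal_exp_log _
  · simp [blockMeasure, hi, digitMeasure_apply, digit00, digit11, digit20, hit]
    exact ofReal_le_ofReal_exp_log _
  · simp [blockMeasure, hi, digitMeasure_apply, digit00, digit11, digit20, hit, hsum,
      ENNReal.ofReal_le_ofReal, Real.le_exp_log]

lemma measure_cell_le {α : ℝ} (hα : α ∈ Set.Icc (0 : ℝ) 1) {ω : CarpetSymb}
    (hω : rowFreq α = α → ∀ i ∈ rowBlock, ω i ≠ digit00) {j : ℕ} (hj : 1 ≤ j) :
    Measure.infinitePi (blockMeasure α) (cell (j + 1).factorial ω) ≤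
      ENNReal.ofReal (Real.exp (logMass α (rowFreq α) (j + 1).factorial ω +
        j.factorial * (|Real.log α| + |Real.log ((1 - α) / 2)|))) := by
  have := isProbabilityMeasure_blockMeasure hα
  set n := (j + 1).factorial with hn
  set K := |Real.log α| + |Real.log ((1 - α) / 2)| with hK
  set S : ℕ → Set CarpetDigit := fun i =>
    if i < matchLen n then {ω i} else {e | e.1.2 = (ω i).1.2} with hS
  have hsub : cell n ω ⊆ Set.pi (Finset.range n : Set ℕ) S := by
    intro η hη i hi
    rw [Finset.mem_coe, Finset.mem_range] at hi
    simp only [hS]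
    split_ifs with h
    · exact hη.1 i h
    · exact hη.2 i hi
  refine (measure_mono hsub).trans ?_
  rw [Measure.infinitePi_pi _ fun i _ => (Set.to_countable (S i)).measurableSet]
  have hsumK : (j.factorial : ℝ) * K =
      ∑ i ∈ Finset.range n, if i < j.factorial then K else 0 := by
    have hle : j.factorial ≤ n := Nat.factorial_le (Nat.le_succ j)
    rw [Finset.range_eq_Ico, ← Finset.sum_Ico_consecutive _ (Nat.zero_le _) hle,
      Finset.sum_congr rfl fun i hi => if_pos (Finset.mem_Ico.1 hi).2,
      Finset.sum_congr (s₁ := Finset.Ico j.factorial n) rfl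
        fun i hi => if_neg (not_lt.2 (Finset.mem_Ico.1 hi).1)]
    simp
  rw [logMass_eq_sum, hsumK, ← Finset.sum_add_distrib, Real.exp_sum,
    ENNReal.ofReal_prod_of_nonneg fun _ _ => (Real.exp_pos _).le]
  refine Finset.prod_le_prod' fun i hi => ?_
  rw [Finset.mem_range] at hi
  by_cases hij : i < j.factorial
  · refine prob_le_one.trans ?_
    rw [if_pos (hij.trans_le (factorial_le_matchLen hj)), if_pos hij, ENNReal.one_le_ofReal,
      Real.one_le_exp_iff]
    have h1 := neg_abs_le (Real.log α)
    have h2 := neg_abs_le (Real.log ((1 - α) / 2))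
    have h3 := abs_nonneg (Real.log α)
    have h4 := abs_nonneg (Real.log ((1 - α) / 2))
    unfold hit
    split_ifs <;> linarith
  · rw [if_neg hij, add_zero]
    by_cases hiL : i < matchLen n
    · simp only [hS, if_pos hiL]
      exact blockMeasure_singleton_le (notMem_rowBlock (not_lt.1 hij) hiL) _
    · simp only [hS, if_neg hiL]
      have hb := mem_rowBlock (not_lt.1 hiL) hi
      exact blockMeasure_row_le hα hb fun h => hω h i hb

lemma eventually_measure_cell_le {α : ℝ} (hα : α ∈ Set.Icc (0 : ℝ) 1) {ω : CarpetSymb}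
    (hω : rowFreq α = α → ∀ i ∈ rowBlock, ω i ≠ digit00) (hlev : ω ∈ carpetLevel phiEx2 α)
    {x : ℝ} (hx : x < massRate α α (rowFreq α)) :
    ∀ᶠ j : ℕ in atTop, Measure.infinitePi (blockMeasure α) (cell (j + 1).factorial ω) ≤
      ENNReal.ofReal (Real.exp (-((j + 1).factorial * x))) := by
  set K := |Real.log α| + |Real.log ((1 - α) / 2)| with hK
  have hfac : Tendsto (fun j : ℕ => (j + 1).factorial) atTop atTop :=
    tendsto_atTop_mono (fun j => (Nat.le_succ j).trans (Nat.self_le_factorial _)) tendsto_id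
  have h1 := (tendsto_logMass hlev α (rowFreq α)).comp hfac
  have h2 : Tendsto (fun j : ℕ => K * (1 / ((j : ℝ) + 1))) atTop (𝓝 0) := by
    simpa using (tendsto_one_div_add_atTop_nhds_zero_nat (𝕜 := ℝ)).const_mul K
  have h3 := h1.add h2
  rw [add_zero] at h3
  filter_upwards [h3.eventually (gt_mem_nhds (neg_lt_neg hx)), eventually_ge_atTop 1] with j hj hj1
  refine (measure_cell_le hα hω hj1).trans
    (ENNReal.ofReal_le_ofReal (Real.exp_le_exp.2 ?_))
  have hpos : (0 : ℝ) < (j + 1).factorial := by exact_mod_cast Nat.factorial_pos _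
  have hj0 : (0 : ℝ) < (j : ℝ) + 1 := by positivity
  have hmul := mul_le_mul_of_nonneg_left hj.le hpos.le
  have he : ((j + 1).factorial : ℝ) * (logMass α (rowFreq α) (j + 1).factorial ω /
      (j + 1).factorial + K * (1 / ((j : ℝ) + 1))) =
      logMass α (rowFreq α) (j + 1).factorial ω + j.factorial * K := by
    have h4 : ((j + 1).factorial : ℝ) = ((j : ℝ) + 1) * j.factorial := by
      rw [Nat.factorial_succ]; push_cast; ring
    rw [mul_add, mul_div_cancel₀ _ hpos.ne', h4]
    field_simp
  simp only [Function.comp] at hmul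
  rw [he] at hmul
  linarith

/-- A set of codes whose approximate squares are small along the scales `(j + 1)!` is null when its
image has small upper box dimension. -/
lemma measure_eq_zero_of_upperBoxDim_lt (μ : Measure CarpetSymb) {C : Set Torus2} {t t' : ℝ}
    (ht : upperBoxDim C < t) (htt : t < t') {F : Set CarpetSymb} {J : ℕ}
    (hFC : ∀ ω ∈ F, carpetCoding ω ∈ C)
    (hF : ∀ ω ∈ F, ∀ j ≥ J, μ (cell (j + 1).factorial ω) ≤
      ENNReal.ofReal (Real.exp (-((j + 1).factorial * (t' * Real.log 2))))) : μ F = 0 := by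
  have hl2 : 0 < Real.log 2 := Real.log_pos one_lt_two
  have hfac : Tendsto (fun j : ℕ => (j + 1).factorial) atTop atTop :=
    tendsto_atTop_mono (fun j => (Nat.le_succ j).trans (Nat.self_le_factorial _)) tendsto_id
  have hr : Tendsto (fun j : ℕ => ((2 : ℝ) ^ ((j + 1).factorial + 1))⁻¹) atTop (𝓝[>] 0) := by
    refine tendsto_nhdsWithin_iff.2 ⟨?_, Eventually.of_forall fun j => by
      simp only [Set.mem_Ioi]; positivity⟩
    exact tendsto_inv_atTop_zero.comp ((tendsto_pow_atTop_atTop_of_one_lt one_lt_two).comp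
      ((tendsto_add_atTop_nat 1).comp hfac))
  have hbound : ∀ᶠ j : ℕ in atTop, μ F ≤ ENNReal.ofReal (9 * Real.exp (t * Real.log 2) *
      Real.exp (-((j + 1).factorial * ((t' - t) * Real.log 2)))) := by
    filter_upwards [hr.eventually (eventually_coverRatio_lt ht), eventually_ge_atTop J]
      with j hj hjJ
    set n := (j + 1).factorial with hn
    have hcov : (coverN C ((2 : ℝ) ^ (n + 1))⁻¹ : ℝ) ≤ Real.exp ((n + 1) * (t * Real.log 2)) := by
      rcases Nat.eq_zero_or_pos (coverN C ((2 : ℝ) ^ (n + 1))⁻¹) with h0 | h0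
      · rw [h0, Nat.cast_zero]; positivity
      · rw [inv_inv, Real.log_pow, div_lt_iff₀ (by positivity)] at hj
        rw [← Real.exp_log (show (0 : ℝ) < coverN C ((2 : ℝ) ^ (n + 1))⁻¹ by exact_mod_cast h0)]
        refine Real.exp_le_exp.2 (hj.le.trans_eq ?_)
        push_cast; ring
    have h1 := measure_le_of_cover μ (n := n) (r := ((2 : ℝ) ^ (n + 1))⁻¹) (by positivity)
      (by rw [pow_succ, mul_inv]; linarith) hFC fun ω hω => hF ω hω j hjJ
    refine h1.trans ?_
    rw [← ENNReal.ofReal_natCast, show (9 : ℝ≥0∞) = ENNReal.ofReal 9 by norm_num,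
      ← ENNReal.ofReal_mul (by norm_num), ← ENNReal.ofReal_mul (by positivity)]
    refine ENNReal.ofReal_le_ofReal ?_
    calc _ ≤ Real.exp ((n + 1) * (t * Real.log 2)) *
          (9 * Real.exp (-(n * (t' * Real.log 2)))) := by gcongr
      _ = 9 * (Real.exp ((n + 1) * (t * Real.log 2)) * Real.exp (-(n * (t' * Real.log 2)))) := by
          ring
      _ = 9 * (Real.exp (t * Real.log 2) * Real.exp (-(n * ((t' - t) * Real.log 2)))) := by
          rw [← Real.exp_add, ← Real.exp_add]; congr 2; ring
      _ = _ := by ring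
  have hlim : Tendsto (fun j : ℕ => ENNReal.ofReal (9 * Real.exp (t * Real.log 2) *
      Real.exp (-((j + 1).factorial * ((t' - t) * Real.log 2))))) atTop (𝓝 0) := by
    rw [← ENNReal.ofReal_zero]
    refine ENNReal.tendsto_ofReal ?_
    have h1 : Tendsto (fun j : ℕ => ((j + 1).factorial : ℝ) * ((t' - t) * Real.log 2))
        atTop atTop :=
      (tendsto_natCast_atTop_atTop.comp hfac).atTop_mul_const
        (mul_pos (sub_pos.2 htt) hl2)
    simpa using (Real.tendsto_exp_neg_atTop_nhds_zero.comp h1).const_mul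
      (9 * Real.exp (t * Real.log 2))
  exact le_antisymm (ge_of_tendsto hlim hbound) bot_le

lemma massRate_le_packingDim {α : ℝ} (hα : α ∈ Set.Icc (0 : ℝ) 1) :
    massRate α α (rowFreq α) / Real.log 2 ≤
      packingDim (carpetCoding '' carpetLevel phiEx2 α) := by
  have hl2 : 0 < Real.log 2 := Real.log_pos one_lt_two
  have := isProbabilityMeasure_blockMeasure hα
  set μ := Measure.infinitePi (blockMeasure α)
  refine le_of_forall_lt_imp_le_of_dense fun t ht => ?_
  obtain ⟨t', htt, ht'⟩ := exists_between ht
  refine le_packingDim fun C hC => ?_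
  by_contra! hlt
  set F : ℕ → ℕ → Set CarpetSymb := fun k J =>
    {ω | carpetCoding ω ∈ C k ∧ ∀ j ≥ J, μ (cell (j + 1).factorial ω) ≤
      ENNReal.ofReal (Real.exp (-((j + 1).factorial * (t' * Real.log 2))))}
  have hnull : ∀ k J, μ (F k J) = 0 := fun k J =>
    measure_eq_zero_of_upperBoxDim_lt μ (hlt k) htt (fun ω hω => hω.1) fun ω hω => hω.2
  have hgood : ∀ᵐ ω ∂μ, rowFreq α = α → ∀ i ∈ rowBlock, ω i ≠ digit00 := by
    by_cases h : rowFreq α = α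
    · filter_upwards [ae_ne_digit00 hα h] with ω hω _ using hω
    · exact ae_of_all _ fun ω h' => absurd h' h
  have hmem : ∀ᵐ ω ∂μ, ω ∈ ⋃ k, ⋃ J, F k J := by
    filter_upwards [hgood, ae_mem_carpetLevel hα] with ω h1 h2
    obtain ⟨k, hk⟩ := Set.mem_iUnion.1 (hC ⟨ω, h2, rfl⟩)
    obtain ⟨J, hJ⟩ := eventually_atTop.1
      (eventually_measure_cell_le hα h1 h2 ((lt_div_iff₀ hl2).1 ht'))
    exact Set.mem_iUnion₂.2 ⟨k, J, hk, hJ⟩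
  have hzero : μ (⋃ k, ⋃ J, F k J) = 0 := by
    simp only [measure_iUnion_null_iff]
    exact hnull
  have hnot : ∀ᵐ ω ∂μ, ω ∉ ⋃ k, ⋃ J, F k J := measure_eq_zero_iff_ae_notMem.1 hzero
  obtain ⟨ω, h1, h2⟩ := (hmem.and hnot).exists
  exact h2 h1

end LowerBound

section Spectrum

lemma massRate_self (α : ℝ) :
    massRate α α (rowFreq α) = specEx2 α * Real.log 2 := by
  have hl2 : 0 < Real.log 2 := Real.log_pos one_lt_two
  have hl3 : 0 < Real.log 3 := Real.log_pos (by norm_num)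
  have hlog : (1 - α) * Real.log ((1 - α) / 2) =
      (1 - α) * (Real.log (1 - α) - Real.log 2) := by
    rcases eq_or_ne (1 - α) 0 with h | h
    · rw [h]; simp
    · rw [Real.log_div h two_ne_zero]
  unfold massRate specEx2
  rw [hlog]
  split_ifs with h
  · rw [show rowFreq α = 1 / 2 from max_eq_right h, show (1 : ℝ) - 1 / 2 = 2⁻¹ by norm_num,
      one_div, Real.log_inv, Real.negMulLog, Real.negMulLog]
    field_simp
    ring
  · rw [show rowFreq α = α from max_eq_left (not_le.1 h).le, Real.negMulLog, Real.negMulLog]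
    field_simp
    ring

lemma packingDim_le_massRate {α β γ : ℝ} (hβ : β ∈ Set.Ioo (0 : ℝ) 1)
    (hγ : γ ∈ Set.Ico (1 / 2 : ℝ) 1) (hα : α ∈ Set.Icc (0 : ℝ) 1) :
    packingDim (carpetCoding '' carpetLevel phiEx2 α) ≤ massRate α β γ / Real.log 2 := by
  have hl2 : 0 < Real.log 2 := Real.log_pos one_lt_two
  have hl3 : 0 < Real.log 3 := Real.log_pos (by norm_num)
  have ha : 0 ≤ 1 - Real.log 2 / Real.log 3 := by
    rw [sub_nonneg, div_le_one hl3]; exact Real.log_le_log (by norm_num) (by norm_num)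
  have hneg : ∀ x y : ℝ, 0 ≤ x → x ≤ 1 → 0 ≤ y → y ≤ 1 →
      α * Real.log x + (1 - α) * Real.log y ≤ 0 := fun x y hx hx1 hy hy1 =>
    add_nonpos (mul_nonpos_of_nonneg_of_nonpos hα.1 (Real.log_nonpos hx hx1))
      (mul_nonpos_of_nonneg_of_nonpos (sub_nonneg.2 hα.2) (Real.log_nonpos hy hy1))
  refine packingDim_image_le hβ hγ (div_nonneg ?_ hl2.le) fun ω hω => ?_
  · have h1 := mul_nonpos_of_nonneg_of_nonpos (div_nonneg hl2.le hl3.le) (hneg β ((1 - β) / 2)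
      hβ.1.le hβ.2.le (by linarith [hβ.2]) (by linarith [hβ.1]))
    have h2 := mul_nonpos_of_nonneg_of_nonpos ha (hneg γ (1 - γ)
      (by linarith [hγ.1]) hγ.2.le (by linarith [hγ.2]) (by linarith [hγ.1]))
    unfold massRate
    linarith
  · rw [div_mul_cancel₀ _ hl2.ne']
    exact tendsto_logMass hω β γ

lemma packingDim_level_le {α : ℝ} (hα : α ∈ Set.Icc (0 : ℝ) 1) :
    packingDim (carpetCoding '' carpetLevel phiEx2 α) ≤ specEx2 α := by
  have hl2 : 0 < Real.log 2 := Real.log_pos one_lt_two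
  rcases hα.1.eq_or_lt with rfl | h0
  · have hc : ContinuousWithinAt (fun β : ℝ => massRate 0 β (1 / 2) / Real.log 2) (Set.Ioi 0) 0 := by
      refine ContinuousAt.continuousWithinAt ?_
      simp only [massRate, zero_mul, zero_add]
      have : ContinuousAt (fun β : ℝ => Real.log ((1 - β) / 2)) 0 :=
        ContinuousAt.log (by fun_prop) (by norm_num)
      fun_prop
    have he : massRate 0 0 (1 / 2) / Real.log 2 = specEx2 0 := by
      rw [eq_comm, eq_div_iff hl2.ne', ← massRate_self _]
      simp [rowFreq]
    rw [← he]
    refine ge_of_tendsto hc ?_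
    filter_upwards [eventually_small one_pos] with β hβ
    exact packingDim_le_massRate hβ ⟨le_rfl, by norm_num⟩ hα
  rcases hα.2.eq_or_lt with rfl | h1
  · have hc : ContinuousWithinAt (fun β : ℝ => massRate 1 β β / Real.log 2) (Set.Iio 1) 1 := by
      refine ContinuousAt.continuousWithinAt ?_
      simp only [massRate, sub_self, zero_mul, add_zero]
      have : ContinuousAt (fun β : ℝ => Real.log β) 1 := Real.continuousAt_log one_ne_zero
      fun_prop
    have he : massRate 1 1 1 / Real.log 2 = specEx2 1 := by
      rw [eq_comm, eq_div_iff hl2.ne', ← massRate_self _]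
      norm_num [rowFreq]
    rw [← he]
    refine ge_of_tendsto hc ?_
    filter_upwards [Ioo_mem_nhdsLT (show (1 / 2 : ℝ) < 1 by norm_num)] with β hβ
    exact packingDim_le_massRate ⟨by linarith [hβ.1], hβ.2⟩ ⟨hβ.1.le, hβ.2⟩ hα
  · refine (packingDim_le_massRate (γ := rowFreq α) ⟨h0, h1⟩
      ⟨half_le_rowFreq α, max_lt h1 (by norm_num)⟩ hα).trans_eq ?_
    rw [massRate_self _, mul_div_cancel_right₀ _ hl2.ne']

lemma packingDim_level_eq {α : ℝ} (hα : α ∈ Set.Icc (0 : ℝ) 1) :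
    packingDim (carpetCoding '' carpetLevel phiEx2 α) = specEx2 α := by
  have hl2 : 0 < Real.log 2 := Real.log_pos one_lt_two
  refine le_antisymm (packingDim_level_le hα) ?_
  have := massRate_le_packingDim hα
  rwa [massRate_self _, mul_div_cancel_right₀ _ hl2.ne'] at this

lemma logMass_third (n : ℕ) (ω : CarpetSymb) :
    logMass (1 / 3) (1 / 2) n ω = -(matchLen n * Real.log 3 + (n - matchLen n) * Real.log 2) := by
  rw [logMass, show ((1 : ℝ) - 1 / 3) / 2 = 3⁻¹ by norm_num, show (1 : ℝ) - 1 / 2 = 2⁻¹ by norm_num,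
    one_div, one_div, Real.log_inv, Real.log_inv]
  ring

lemma nonempty_carpetLevel {α : ℝ} (hα : α ∈ Set.Icc (0 : ℝ) 1) :
    (carpetLevel phiEx2 α).Nonempty := by
  have := isProbabilityMeasure_blockMeasure hα
  exact (ae_mem_carpetLevel hα).exists

lemma packingDim_carpet_le : packingDim carpet ≤ specEx2 (1 / 3) := by
  have hl2 : 0 < Real.log 2 := Real.log_pos one_lt_two
  have hα : (1 / 3 : ℝ) ∈ Set.Icc (0 : ℝ) 1 := by constructor <;> norm_num
  obtain ⟨ω₀, hω₀⟩ := nonempty_carpetLevel hα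
  have hs : 0 ≤ specEx2 (1 / 3) := by
    rw [← packingDim_level_eq hα]
    exact Real.iInf_nonneg fun C => Real.iSup_nonneg fun n => upperBoxDim_nonneg _
  have hγ : rowFreq (1 / 3) = 1 / 2 := max_eq_right (by norm_num)
  rw [carpet, ← Set.image_univ]
  refine packingDim_image_le (β := 1 / 3) (γ := 1 / 2) (by constructor <;> norm_num)
    (by constructor <;> norm_num) hs fun ω _ => ?_
  have := tendsto_logMass hω₀ (1 / 3) (1 / 2)
  rw [← hγ, massRate_self _, hγ] at this
  simpa only [logMass_third] using this

lemma not_analyticOnNhd_specEx2 : ¬ AnalyticOnNhd ℝ specEx2 (Set.Ioo (0 : ℝ) 1) := by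
  intro h
  have hl2 : 0 < Real.log 2 := Real.log_pos one_lt_two
  have hl23 : Real.log 2 < Real.log 3 := Real.log_lt_log (by norm_num) (by norm_num)
  have hl3 : 0 < Real.log 3 := hl2.trans hl23
  set g : ℝ → ℝ := fun α =>
    (-α * Real.log α + -(1 - α) * Real.log (1 - α) - α * Real.log 2) / Real.log 3 + 1
  have hg : AnalyticOnNhd ℝ g (Set.Ioo (0 : ℝ) 1) := by
    intro x hx
    have h1 : AnalyticAt ℝ (fun α : ℝ => Real.log α) x := analyticAt_id.log hx.1
    have h2 : AnalyticAt ℝ (fun α : ℝ => Real.log (1 - α)) x :=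
      (analyticAt_const.sub analyticAt_id).log (sub_pos.2 hx.2)
    fun_prop (disch := exact hl3.ne')
  have heq : specEx2 =ᶠ[𝓝 (1 / 4)] g := by
    filter_upwards [Iio_mem_nhds (show (1 / 4 : ℝ) < 1 / 2 by norm_num)] with α hα
    rw [specEx2, if_pos (le_of_lt hα), Real.negMulLog, Real.negMulLog]
  have key := h.eqOn_of_preconnected_of_eventuallyEq hg isPreconnected_Ioo
    (by constructor <;> norm_num) heq (show (3 / 4 : ℝ) ∈ Set.Ioo (0 : ℝ) 1 by
      constructor <;> norm_num)
  have hent : Real.binEntropy (3 / 4) < Real.log 2 := Real.binEntropy_lt_log_two.2 (by norm_num)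
  rw [Real.binEntropy_eq_negMulLog_add_negMulLog_one_sub] at hent
  have hg' : g (3 / 4) = (Real.negMulLog (3 / 4) + Real.negMulLog (1 - 3 / 4) -
      3 / 4 * Real.log 2) / Real.log 3 + 1 := by
    simp only [g, Real.negMulLog]
  rw [hg', specEx2, if_neg (by norm_num)] at key
  set e := Real.negMulLog (3 / 4) + Real.negMulLog (1 - 3 / 4)
  field_simp at key
  have : (Real.log 2 - e) * (Real.log 3 - Real.log 2) = 0 := by linarith
  exact absurd this (mul_pos (sub_pos.2 hent) (sub_pos.2 hl23)).ne'

end Spectrum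

/-- **Example 2.** On the Bedford–McMullen carpet with `a₁ = 3`, `a₂ = 2`,
`D = {(0,0),(1,1),(2,0)}`, the packing spectrum of `φ` has the given piecewise form; it is not
real analytic on `(0,1)` and attains the full packing dimension `dim_P Λ` at `α = 1/3`. -/
theorem bedford_mcmullen_example_two :
    (∀ α ∈ Set.Icc (0 : ℝ) 1,
      packingDim (carpetCoding '' carpetLevel phiEx2 α) = specEx2 α) ∧
    ¬ AnalyticOnNhd ℝ (fun α => packingDim (carpetCoding '' carpetLevel phiEx2 α))
      (Set.Ioo (0 : ℝ) 1) ∧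
    packingDim (carpetCoding '' carpetLevel phiEx2 (1 / 3)) = packingDim carpet := by
  have hmem : (1 / 3 : ℝ) ∈ Set.Icc (0 : ℝ) 1 := by constructor <;> norm_num
  refine ⟨fun α hα => packingDim_level_eq hα, fun h => not_analyticOnNhd_specEx2 ?_,
    le_antisymm (packingDim_mono (Set.image_subset_range _ _)) ?_⟩
  · exact h.congr isOpen_Ioo fun α hα => packingDim_level_eq (Set.Ioo_subset_Icc_self hα)
  · rw [packingDim_level_eq hmem]
    exact packingDim_carpet_le

end
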